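/- arXiv:2402.14988 — 5 statements merged into one kernel-verified Lean document; each statement's English description precedes it below -/
import Mathlib

section
/- Let s_1,…,s_m and 𝔾 be positive integers, let ζ = 1/(m+1), let x = (ζ,…,ζ) ∈ ℝ^m, and define f : ℝ^m → ℝ by f(z) = ∑_{i : z_i > s_i} s_i. Then f(z) < 𝔾 holds for every z ∈ ℝ^m with ‖z − x‖₁ ≤ 𝔾 if and only if there is no subset J ⊆ {1,…,m} with ∑_{j∈J} s_j = 𝔾. (This is the correctness of the paper's reduction from Subset Sum to robustness verification of a large-spread boosted ensemble of m regression stumps t_i = σ(i, s_i, λ(0), λ(s_i)) against the attacker A_{1,𝔾}, with identity inverse link function and threshold τ = 𝔾, on the instance x with true label −1.) -/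
open Classical in
/-- correctness of the reduction from Subset Sum to robustness
verification against the `L1`-attacker `A_{1,𝔾}`.
Given positive integers `s 1, …, s m` and `𝔾`, with `ζ = 1/(m+1)`,
`x = (ζ,…,ζ)` and `f z = ∑_{i : z i > s i} s i` (the raw prediction of the stump
ensemble `t i = σ(i, s i, λ 0, λ (s i))` with identity inverse link and threshold
`τ = 𝔾`), we have: `f z < 𝔾` for every `z` with `‖z − x‖₁ ≤ 𝔾` iff no subset of
`{s 1, …, s m}` sums to `𝔾`. -/
theorem ssp_reduction_l1_correct
    (m : ℕ) (s : Fin m → ℤ) (hs : ∀ i, 0 < s i) (G : ℤ) (hG : 0 < G) :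
    (∀ z : Fin m → ℝ,
        (∑ i, |z i - 1 / (m + 1)|) ≤ (G : ℝ) →
        (∑ i ∈ Finset.univ.filter (fun i : Fin m => (s i : ℝ) < z i), (s i : ℝ)) < (G : ℝ)) ↔
      ¬ ∃ J : Finset (Fin m), ∑ j ∈ J, s j = G := by
  constructor
  · rintro h ⟨J, hJ⟩
    have hζ : 0 < (1 : ℝ) / (m + 1) := by positivity
    have hζ1 : (1 : ℝ) / (m + 1) ≤ 1 := by
      rw [div_le_one (by positivity)]
      linarith [(Nat.cast_nonneg m : (0 : ℝ) ≤ m)]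
    have hJ' : ∑ j ∈ J, (s j : ℝ) = G := mod_cast hJ
    let z : Fin m → ℝ := fun i => if i ∈ J then s i + 1 / (m + 1) else 1 / (m + 1)
    have hdist : ∑ i, |z i - 1 / (m + 1)| = G := by
      have hterm (i : Fin m) : |z i - 1 / (m + 1)| = if i ∈ J then (s i : ℝ) else 0 := by
        have hpos : (0 : ℝ) < s i := mod_cast hs i
        by_cases hi : i ∈ J
        · simp only [z, hi, if_true, add_sub_cancel_right, abs_of_pos hpos]
        · simp [z, hi]
      simp only [hterm, Finset.sum_ite_mem, Finset.univ_inter, hJ']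
    have hfilter : Finset.univ.filter (fun i => (s i : ℝ) < z i) = J := by
      ext i
      have h1 : (1 : ℝ) ≤ s i := mod_cast hs i
      by_cases hi : i ∈ J
      · simp only [Finset.mem_filter_univ, z, hi, if_true, lt_add_iff_pos_right, hζ]
      · simp only [Finset.mem_filter_univ, z, hi, if_false, iff_false, not_lt, hζ1.trans h1]
    have hlt := h z hdist.le
    rw [hfilter, hJ'] at hlt
    exact lt_irrefl _ hlt
  · intro h z hz
    by_contra! hge
    set J := Finset.univ.filter (fun i : Fin m => (s i : ℝ) < z i) with hJ
    refine h ⟨J, le_antisymm ?_ (mod_cast hge)⟩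
    have hlower : ∑ i ∈ J, ((s i : ℝ) - 1 / (m + 1)) ≤ G :=
      calc ∑ i ∈ J, ((s i : ℝ) - 1 / (m + 1))
          ≤ ∑ i ∈ J, |z i - 1 / (m + 1)| := by
            refine Finset.sum_le_sum fun i hi => le_trans ?_ (le_abs_self _)
            exact sub_le_sub_right (Finset.mem_filter.mp hi).2.le _
        _ ≤ ∑ i, |z i - 1 / (m + 1)| :=
            Finset.sum_le_sum_of_subset_of_nonneg (Finset.subset_univ J)
              fun _ _ _ => abs_nonneg _
        _ ≤ G := hz
    rw [Finset.sum_sub_distrib, Finset.sum_const, nsmul_eq_mul] at hlower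
    have hcard : (J.card : ℝ) * (1 / (m + 1)) < 1 := by
      have hle : (J.card : ℝ) ≤ m := mod_cast card_finset_fin_le J
      rw [mul_one_div, div_lt_one (by positivity)]
      linarith
    have hlt : (∑ i ∈ J, (s i : ℝ)) < G + 1 := by linarith
    exact Int.lt_add_one_iff.mp (mod_cast hlt)
end

section
/- Let s_1,…,s_m and 𝔾 be positive integers, let d = ∑_{i=1}^m s_i, index the coordinates of ℝ^d by pairs (i,j) with 1 ≤ i ≤ m and 1 ≤ j ≤ s_i, let x = 0 ∈ ℝ^d, and define f : ℝ^d → ℝ by f(z) = ∑_{i : z_{(i,j)} > 1 for all j ∈ {1,…,s_i}} s_i. Then f(z) < 𝔾 holds for every z ∈ ℝ^d with ‖z − x‖₀ ≤ 𝔾 if and only if there is no subset J ⊆ {1,…,m} with ∑_{j∈J} s_j = 𝔾. (This is the correctness of the paper's reduction from Subset Sum to robustness verification of a large-spread boosted ensemble of m chain-shaped regression trees against the attacker A_{0,𝔾}, with identity inverse link function and threshold τ = 𝔾, on the instance x with true label −1.) -/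
open Classical in
/-- correctness of the reduction from Subset Sum to robustness
verification against the `L0`-attacker `A_{0,𝔾}`.
Given positive integers `s 1, …, s m` and `𝔾`, coordinates are indexed by pairs
`(i,j)` with `1 ≤ i ≤ m`, `1 ≤ j ≤ s i` (so `d = ∑ i, s i`), `x = 0`, and
`f z = ∑_{i : z (i,j) > 1 for all j} s i` (the raw prediction of the ensemble of
chain-shaped trees with identity inverse link and threshold `τ = 𝔾`).
Then `f z < 𝔾` holds for every `z` with `‖z − x‖₀ ≤ 𝔾` iff no subset of
`{s 1, …, s m}` sums to `𝔾`. -/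
theorem ssp_reduction_l0_correct
    (m : ℕ) (s : Fin m → ℕ) (hs : ∀ i, 0 < s i) (G : ℕ) (hG : 0 < G) :
    (∀ z : ((i : Fin m) × Fin (s i)) → ℝ,
        (Finset.univ.filter (fun c : (i : Fin m) × Fin (s i) => z c ≠ 0)).card ≤ G →
        (∑ i ∈ Finset.univ.filter (fun i : Fin m => ∀ j : Fin (s i), 1 < z ⟨i, j⟩),
            (s i : ℝ)) < (G : ℝ)) ↔
      ¬ ∃ J : Finset (Fin m), ∑ j ∈ J, s j = G := by
  constructor
  · rintro h ⟨J, rfl⟩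
    refine (h (fun c => if c.1 ∈ J then 2 else 0) ?_).ne ?_
    · have : Finset.univ.filter (fun c : (i : Fin m) × Fin (s i) =>
          (if c.1 ∈ J then (2 : ℝ) else 0) ≠ 0) = J.sigma fun _ => Finset.univ := by
        ext c
        simp
      rw [this, Finset.card_sigma]
      simp
    · have : Finset.univ.filter (fun i : Fin m => ∀ _ : Fin (s i),
          (1 : ℝ) < if i ∈ J then 2 else 0) = J := by
        ext i
        have : Nonempty (Fin (s i)) := ⟨⟨0, hs i⟩⟩
        by_cases hi : i ∈ J <;> simp [hi]
      rw [this]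
      exact (Nat.cast_sum _ _).symm
  · intro h z hz
    set J := Finset.univ.filter (fun i : Fin m => ∀ j : Fin (s i), 1 < z ⟨i, j⟩) with hJ
    have hle : ∑ i ∈ J, s i ≤ G := by
      calc ∑ i ∈ J, s i = (J.sigma fun i => (Finset.univ : Finset (Fin (s i)))).card := by
            simp [Finset.card_sigma]
        _ ≤ _ := Finset.card_le_card fun c hc => by
            simp only [hJ, Finset.mem_sigma, Finset.mem_filter, Finset.mem_univ, true_and,
              and_true] at hc ⊢
            exact (zero_lt_one.trans (hc c.2)).ne'
        _ ≤ G := hz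
    exact_mod_cast hle.lt_of_ne fun e => h ⟨J, e⟩
end

section
/- Let T = {t_1,…,t_m} be a set of regression trees over ℝ^d, let p ∈ ℕ ∪ {∞} with p ≥ 1 or p = ∞, and let k > 0. Suppose that for every feature f and every pair of thresholds v, v' occurring on feature f in two distinct trees of T, |v − v'| > 2k. Then for every x ∈ ℝ^d and every δ ∈ ℝ^d with ‖δ‖_p ≤ k, and for every feature f, there is at most one tree of T containing an internal node σ(f,v,·,·) whose branching decision differs between x and x + δ, i.e., such that (x_f ≤ v) and (x_f + δ_f ≤ v) are not equivalent. -/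
/-- The `L_p`-norm of a vector `u ∈ ℝ^d`, for `p ∈ ℕ` with `p ≥ 1` or `p = ∞`
(modeled as `p : ℕ∞`): `‖u‖_∞ = max_c |u c|` and
`‖u‖_p = (∑ c, |u c| ^ p) ^ (1/p)` for finite `p`. -/
noncomputable def pNorm {d : ℕ} (p : ℕ∞) (u : Fin d → ℝ) : ℝ :=
  if p = ⊤ then ⨆ c, |u c|
  else (∑ c, |u c| ^ p.toNat) ^ ((1 : ℝ) / p.toNat)

/-- A regression tree over `ℝ^d`: either a leaf `λ(s)` with score `s ∈ ℝ`, or an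
internal node `σ(f,v,l,r)` with feature `f`, threshold `v` and subtrees `l`, `r`;
an instance `x` traverses it going left when `x f ≤ v` and right otherwise. -/
inductive RTree (d : ℕ) : Type where
  | leaf (s : ℝ) : RTree d
  | node (f : Fin d) (v : ℝ) (l r : RTree d) : RTree d

/-- `t.hasThreshold f v` holds iff the tree `t` contains an internal node
`σ(f,v,·,·)`, i.e., threshold `v` occurs on feature `f` in `t`. -/
def RTree.hasThreshold {d : ℕ} : RTree d → Fin d → ℝ → Prop
  | .leaf _, _, _ => False
  | .node f v l r, g, w => (f = g ∧ v = w) ∨ l.hasThreshold g w ∨ r.hasThreshold g w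

theorem abs_apply_le_pNorm {d : ℕ} {p : ℕ∞} (hp : 1 ≤ p) (u : Fin d → ℝ) (c : Fin d) :
    |u c| ≤ pNorm p u := by
  unfold pNorm
  split_ifs with h
  · exact le_ciSup (f := fun c => |u c|) (Set.finite_range _).bddAbove c
  · have hp0 : p.toNat ≠ 0 := by
      rw [Ne, ENat.toNat_eq_zero]
      rintro (rfl | rfl)
      · exact absurd hp (by decide)
      · exact h rfl
    calc |u c| = (|u c| ^ p.toNat) ^ ((1 : ℝ) / p.toNat) := by
          rw [one_div, Real.pow_rpow_inv_natCast (abs_nonneg _) hp0]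
      _ ≤ (∑ c, |u c| ^ p.toNat) ^ ((1 : ℝ) / p.toNat) := by
          gcongr
          exact Finset.single_le_sum (f := fun c => |u c| ^ p.toNat)
            (fun _ _ => by positivity) (Finset.mem_univ c)

theorem abs_sub_le_abs_of_not_le_iff_add_le {a b v : ℝ} (h : ¬(a ≤ v ↔ a + b ≤ v)) :
    |a - v| ≤ |b| := by
  grind

/-- under the large-spread condition (thresholds on the same feature
in distinct trees are more than `2k` apart), for every `x` and every perturbation
`δ` with `‖δ‖_p ≤ k` (`p ≥ 1` or `p = ∞`), and every feature `f`, at most one tree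
of the ensemble contains an internal node `σ(f,v,·,·)` whose branching decision
differs between `x` and `x + δ`, i.e., such that `x f ≤ v` and `x f + δ f ≤ v` are
not equivalent. -/
theorem large_spread_at_most_one_tree_crossed
    {d m : ℕ} (p : ℕ∞) (hp : 1 ≤ p) (k : ℝ) (hk : 0 < k)
    (T : Fin m → RTree d)
    (hLS : ∀ i j : Fin m, i ≠ j → ∀ f v v',
      (T i).hasThreshold f v → (T j).hasThreshold f v' → 2 * k < |v - v'|)
    (x δ : Fin d → ℝ) (hδ : pNorm p δ ≤ k) (f : Fin d) :
    ∀ i j : Fin m,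
      (∃ v, (T i).hasThreshold f v ∧ ¬((x f ≤ v) ↔ (x f + δ f ≤ v))) →
      (∃ v, (T j).hasThreshold f v ∧ ¬((x f ≤ v) ↔ (x f + δ f ≤ v))) →
      i = j := by
  rintro i j ⟨v, hv, hxv⟩ ⟨w, hw, hxw⟩
  by_contra hij
  have h1 := hLS i j hij f v w hv hw
  have h2 := abs_sub_le_abs_of_not_le_iff_add_le hxv
  have h3 := abs_sub_le_abs_of_not_le_iff_add_le hxw
  have h4 := (abs_apply_le_pNorm hp δ f).trans hδ
  have h5 := abs_sub_le v (x f) w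
  rw [abs_sub_comm v (x f)] at h5
  linarith
end

section
/- Let T = {t_1,…,t_m} be a boosted tree ensemble over ℝ^d that is large-spread for the attacker A_{p,k}, with p ∈ ℕ ∪ {∞}, p ≥ 1 or p = ∞, and k > 0, and let x ∈ ℝ^d. Then for any two distinct trees t_i ≠ t_j of T and any leaves λ ∈ L(t_i,x) and λ' ∈ L(t_j,x), the vectors dist(x,λ) and dist(x,λ') have disjoint supports: no coordinate is nonzero in both. -/
/-- The `L₀`-norm of `u ∈ ℝ^d`: the number of nonzero coordinates of `u`. -/
noncomputable def zeroNorm {d : ℕ} (u : Fin d → ℝ) : ℕ :=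
  (Finset.univ.filter (fun c => u c ≠ 0)).card

/-- A hyper-rectangle `∏ i, (lo i, hi i]` with (possibly infinite) extended-real
bounds, annotating a leaf of a decision tree. -/
structure HRect (d : ℕ) where
  lo : Fin d → EReal
  hi : Fin d → EReal

/-- The annotation procedure: the leaves of `t`, each paired with its
hyper-rectangle, starting from the hyper-rectangle `H` at the root. -/
noncomputable def RTree.annotLeaves {d : ℕ} : RTree d → HRect d → List (ℝ × HRect d)
  | .leaf s, H => [(s, H)]
  | .node f v l r, H =>
      l.annotLeaves ⟨H.lo, fun i => if i = f then min (H.hi i) (v : EReal) else H.hi i⟩ ++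
      r.annotLeaves ⟨fun i => if i = f then max (H.lo i) (v : EReal) else H.lo i, H.hi⟩

/-- The annotated leaves of `t`, starting from `(-∞, +∞]^d` at the root; the finite
bounds of each leaf's hyper-rectangle are thresholds of `t` on the corresponding
feature. -/
noncomputable def RTree.leaves {d : ℕ} (t : RTree d) : List (ℝ × HRect d) :=
  t.annotLeaves ⟨fun _ => ⊥, fun _ => ⊤⟩

/-- The minimal adversarial perturbation `dist(x, λ)` pushing `x` into the
hyper-rectangle `H` annotating a leaf `λ` (with tick `ε`): its `i`-th coordinate is
`0` if `x i ∈ (lo i, hi i]`, `lo i − x i + ε` if `x i ≤ lo i`, and `hi i − x i`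
if `x i > hi i`. -/
noncomputable def distLeaf {d : ℕ} (ε : ℝ) (x : Fin d → ℝ) (H : HRect d) : Fin d → ℝ :=
  fun i =>
    if H.lo i < (x i : EReal) ∧ (x i : EReal) ≤ H.hi i then 0
    else if (x i : EReal) ≤ H.lo i then (H.lo i).toReal - x i + ε
    else (H.hi i).toReal - x i

/-- Each bound of an annotated leaf is inherited from the root or is a threshold of the tree. -/
theorem RTree.bounds_of_mem_annotLeaves {d : ℕ} (t : RTree d) (H : HRect d)
    {lf : ℝ × HRect d} (hlf : lf ∈ t.annotLeaves H) (c : Fin d) :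
    (lf.2.lo c = H.lo c ∨ ∃ v : ℝ, t.hasThreshold c v ∧ lf.2.lo c = v) ∧
    (lf.2.hi c = H.hi c ∨ ∃ v : ℝ, t.hasThreshold c v ∧ lf.2.hi c = v) := by
  induction t generalizing H with
  | leaf s =>
    simp only [RTree.annotLeaves, List.mem_singleton] at hlf
    subst hlf
    exact ⟨Or.inl rfl, Or.inl rfl⟩
  | node f v l r ihl ihr =>
    simp only [RTree.annotLeaves, List.mem_append] at hlf
    simp only [RTree.hasThreshold]
    rcases hlf with hlf | hlf
    · obtain ⟨hlo, hhi⟩ := ihl _ hlf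
      dsimp only at hlo hhi
      refine ⟨hlo.imp_right fun ⟨w, hw, e⟩ => ⟨w, Or.inr (Or.inl hw), e⟩, ?_⟩
      rcases hhi with e | ⟨w, hw, e⟩
      · by_cases hc : c = f
        · rw [e, if_pos hc]
          exact (min_choice (H.hi c) (v : EReal)).imp_right
            fun e' => ⟨v, Or.inl ⟨hc.symm, rfl⟩, e'⟩
        · exact Or.inl (by rw [e, if_neg hc])
      · exact Or.inr ⟨w, Or.inr (Or.inl hw), e⟩
    · obtain ⟨hlo, hhi⟩ := ihr _ hlf
      dsimp only at hlo hhi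
      refine ⟨?_, hhi.imp_right fun ⟨w, hw, e⟩ => ⟨w, Or.inr (Or.inr hw), e⟩⟩
      rcases hlo with e | ⟨w, hw, e⟩
      · by_cases hc : c = f
        · rw [e, if_pos hc]
          exact (max_choice (H.lo c) (v : EReal)).imp_right
            fun e' => ⟨v, Or.inl ⟨hc.symm, rfl⟩, e'⟩
        · exact Or.inl (by rw [e, if_neg hc])
      · exact Or.inr ⟨w, Or.inr (Or.inr hw), e⟩

/-- A nonzero coordinate of the perturbation into a leaf comes from a threshold of the tree
at distance at most the size of that coordinate. -/
theorem exists_threshold_of_distLeaf_ne_zero {d : ℕ} {ε : ℝ} (hε : 0 ≤ ε) (x : Fin d → ℝ)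
    (t : RTree d) {lf : ℝ × HRect d} (hlf : lf ∈ t.leaves) {c : Fin d}
    (hc : distLeaf ε x lf.2 c ≠ 0) :
    ∃ v, t.hasThreshold c v ∧ |v - x c| ≤ |distLeaf ε x lf.2 c| := by
  obtain ⟨hlo, hhi⟩ := t.bounds_of_mem_annotLeaves _ hlf c
  unfold distLeaf at hc ⊢
  split_ifs at hc ⊢ with h1 h2
  · exact absurd rfl hc
  · rcases hlo with e | ⟨v, hv, e⟩
    · simp [e] at h2
    · refine ⟨v, hv, ?_⟩
      rw [e, EReal.coe_le_coe_iff] at h2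
      rw [e, EReal.toReal_coe, abs_of_nonneg (by linarith), abs_of_nonneg (by linarith)]
      linarith
  · rcases hhi with e | ⟨v, hv, e⟩
    · exact absurd ⟨not_le.1 h2, e ▸ le_top⟩ h1
    · exact ⟨v, hv, by rw [e, EReal.toReal_coe]⟩

/-- in a large-spread boosted ensemble `T` (thresholds on the same
feature in distinct trees are more than `2k` apart), for any two distinct trees
`T i ≠ T j` and any leaves `λ ∈ L(T i, x)` and `λ' ∈ L(T j, x)` (i.e., leaves whose
minimal adversarial perturbations have `p`-norm at most `k`), the vectors
`dist(x, λ)` and `dist(x, λ')` have disjoint supports: no coordinate is nonzero in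
both. -/
theorem large_spread_dist_disjoint_supports
    {d m : ℕ} (p : ℕ∞) (hp : 1 ≤ p) (k : ℝ) (hk : 0 < k) (ε : ℝ) (hε : 0 < ε)
    (T : Fin m → RTree d)
    (hLS : ∀ i j : Fin m, i ≠ j → ∀ f v v',
      (T i).hasThreshold f v → (T j).hasThreshold f v' → 2 * k < |v - v'|)
    (x : Fin d → ℝ) (i j : Fin m) (hij : i ≠ j)
    (lf lf' : ℝ × HRect d)
    (hlf : lf ∈ (T i).leaves) (hlfk : pNorm p (distLeaf ε x lf.2) ≤ k)
    (hlf' : lf' ∈ (T j).leaves) (hlfk' : pNorm p (distLeaf ε x lf'.2) ≤ k) :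
    ∀ c : Fin d, distLeaf ε x lf.2 c = 0 ∨ distLeaf ε x lf'.2 c = 0 := by
  intro c
  by_contra! hne
  obtain ⟨v, hv, hvx⟩ := exists_threshold_of_distLeaf_ne_zero hε.le x (T i) hlf hne.1
  obtain ⟨w, hw, hwx⟩ := exists_threshold_of_distLeaf_ne_zero hε.le x (T j) hlf' hne.2
  have hspread := hLS i j hij c v w hv hw
  have hvk := (hvx.trans (abs_apply_le_pNorm hp _ c)).trans hlfk
  have hwk := (hwx.trans (abs_apply_le_pNorm hp _ c)).trans hlfk'
  have htri := abs_sub_le v (x c) w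
  rw [abs_sub_comm (x c) w] at htri
  linarith
end

section
/- Let T = {t_1,…,t_m} be a boosted tree ensemble over ℝ^d that is large-spread for the attacker A_{p,k}, with p ∈ ℕ ∪ {∞}, p ≥ 1 or p = ∞, and k > 0. Then for every x ∈ ℝ^d and every δ ∈ ℝ^d with ‖δ‖_p ≤ k, there exist vectors δ_1,…,δ_m ∈ ℝ^d with pairwise disjoint supports such that: (i) each δ_i agrees with δ on its support (so ‖∑_{i=1}^m δ_i‖_p ≤ ‖δ‖_p ≤ k); (ii) t_i(x + δ_i) = t_i(x + δ) for every i; and (iii) t_i(x + ∑_{j=1}^m δ_j) = t_i(x + δ_i) for every i. Consequently T̂(x + ∑_j δ_j) = ∑_{i=1}^m t_i(x + δ_i) = T̂(x + δ). -/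
/-- Evaluation of a regression tree: `x` goes left when `x f ≤ v`, right otherwise,
and `t x` is the score of the leaf reached. -/
noncomputable def RTree.eval {d : ℕ} : RTree d → (Fin d → ℝ) → ℝ
  | .leaf s, _ => s
  | .node f v l r, x => if x f ≤ v then l.eval x else r.eval x

/-- The raw prediction `T̂ x = ∑ i, t i x` of the ensemble `T = {t 1, …, t m}`. -/
noncomputable def rawPred {d m : ℕ} (T : Fin m → RTree d) (x : Fin d → ℝ) : ℝ :=
  ∑ i, (T i).eval x

/-- `pNorm p` is monotone in the absolute values of the coordinates. -/
theorem pNorm_le_pNorm {d : ℕ} (p : ℕ∞) {u w : Fin d → ℝ} (h : ∀ c, |u c| ≤ |w c|) :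
    pNorm p u ≤ pNorm p w := by
  unfold pNorm
  split_ifs
  · exact ciSup_mono (Set.finite_range _).bddAbove h
  · refine Real.rpow_le_rpow (Finset.sum_nonneg fun c _ => by positivity) ?_ (by positivity)
    exact Finset.sum_le_sum fun c _ => pow_le_pow_left₀ (abs_nonneg _) (h c) _

/-- Instances on the same side of every threshold of a tree get the same prediction. -/
theorem RTree.eval_congr {d : ℕ} (t : RTree d) {y z : Fin d → ℝ}
    (h : ∀ f v, t.hasThreshold f v → (y f ≤ v ↔ z f ≤ v)) : t.eval y = t.eval z := by
  induction t with
  | leaf s => rfl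
  | node f v l r ihl ihr =>
    simp only [RTree.eval, h f v (Or.inl ⟨rfl, rfl⟩),
      ihl fun g w hw => h g w (Or.inr (Or.inl hw)),
      ihr fun g w hw => h g w (Or.inr (Or.inr hw))]

/-- Moving from `x` to `x + δ` along feature `c` crosses a threshold of `t`. -/
def RTree.Crosses {d : ℕ} (t : RTree d) (x δ : Fin d → ℝ) (c : Fin d) : Prop :=
  ∃ v, t.hasThreshold c v ∧ ¬(x c ≤ v ↔ x c + δ c ≤ v)

/-- A tree does not see a perturbation `ε` that differs from `δ` only by vanishing on
features along which `δ` crosses no threshold of the tree. -/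
theorem RTree.eval_add_eq {d : ℕ} (t : RTree d) {x δ ε : Fin d → ℝ}
    (h : ∀ c, ε c = δ c ∨ (ε c = 0 ∧ ¬t.Crosses x δ c)) :
    t.eval (x + ε) = t.eval (x + δ) := by
  refine t.eval_congr fun c v hv => ?_
  rcases h c with h | ⟨h, hc⟩
  · simp [h]
  · have : x c ≤ v ↔ x c + δ c ≤ v := by
      by_contra hn
      exact hc ⟨v, hv, hn⟩
    simpa [h] using this

theorem abs_sub_le_of_not_le_iff {a e v : ℝ} (h : ¬(a ≤ v ↔ a + e ≤ v)) : |a - v| ≤ |e| := by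
  have h1 := le_abs_self e
  have h2 := neg_le_abs e
  rw [abs_le]
  by_cases ha : a ≤ v <;> by_cases hb : a + e ≤ v <;> simp_all <;> constructor <;> linarith

/-- the decomposition property of large-spread ensembles.
If `T` is large-spread for `A_{p,k}` (`p ≥ 1` or `p = ∞`, `k > 0`), then every
perturbation `δ` with `‖δ‖_p ≤ k` decomposes into vectors `δ 1, …, δ m` with
pairwise disjoint supports such that: (i) each `δ i` agrees with `δ` on its support
(so `‖∑ i, δ i‖_p ≤ ‖δ‖_p ≤ k`); (ii) `t i (x + δ i) = t i (x + δ)` for every `i`;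
and (iii) `t i (x + ∑ j, δ j) = t i (x + δ i)` for every `i`. Consequently
`T̂ (x + ∑ j, δ j) = ∑ i, t i (x + δ i) = T̂ (x + δ)`. -/
theorem large_spread_decomposition
    {d m : ℕ} (p : ℕ∞) (hp : 1 ≤ p) (k : ℝ) (hk : 0 < k)
    (T : Fin m → RTree d)
    (hLS : ∀ i j : Fin m, i ≠ j → ∀ f v v',
      (T i).hasThreshold f v → (T j).hasThreshold f v' → 2 * k < |v - v'|)
    (x δ : Fin d → ℝ) (hδ : pNorm p δ ≤ k) :
    ∃ δs : Fin m → Fin d → ℝ,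
      (∀ i j : Fin m, i ≠ j → ∀ c : Fin d, δs i c = 0 ∨ δs j c = 0) ∧
      (∀ i : Fin m, ∀ c : Fin d, δs i c = 0 ∨ δs i c = δ c) ∧
      pNorm p (∑ i, δs i) ≤ pNorm p δ ∧ pNorm p δ ≤ k ∧
      (∀ i : Fin m, (T i).eval (x + δs i) = (T i).eval (x + δ)) ∧
      (∀ i : Fin m, (T i).eval (x + ∑ j, δs j) = (T i).eval (x + δs i)) ∧
      rawPred T (x + ∑ j, δs j) = ∑ i, (T i).eval (x + δs i) ∧
      rawPred T (x + ∑ j, δs j) = rawPred T (x + δ) := by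
  classical
  have hdisj : ∀ i j : Fin m, i ≠ j → ∀ c,
      (T i).Crosses x δ c → ¬(T j).Crosses x δ c := by
    rintro i j hij c ⟨v, hv, hvx⟩ ⟨w, hw, hwx⟩
    have hlt := hLS i j hij c v w hv hw
    have hc := abs_apply_le_pNorm hp δ c
    have hva := abs_sub_le_of_not_le_iff hvx
    have hwa := abs_sub_le_of_not_le_iff hwx
    have htri := abs_sub_le v (x c) w
    rw [abs_sub_comm v (x c)] at htri
    linarith
  let δs : Fin m → Fin d → ℝ := fun i c => if (T i).Crosses x δ c then δ c else 0
  have hsum : ∀ c, (∑ i, δs i) c = δ c ∨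
      ((∑ i, δs i) c = 0 ∧ ∀ i, ¬(T i).Crosses x δ c) := by
    intro c
    rw [Finset.sum_apply]
    by_cases h : ∃ i, (T i).Crosses x δ c
    · obtain ⟨i, hi⟩ := h
      left
      rw [Finset.sum_eq_single i (fun j _ hj => if_neg (hdisj i j hj.symm c hi)) (by simp)]
      exact if_pos hi
    · push Not at h
      exact Or.inr ⟨Finset.sum_eq_zero fun i _ => if_neg (h i), h⟩
  have hone : ∀ i, (T i).eval (x + δs i) = (T i).eval (x + δ) := fun i =>
    (T i).eval_add_eq fun c => by
      by_cases h : (T i).Crosses x δ c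
      · exact Or.inl (if_pos h)
      · exact Or.inr ⟨if_neg h, h⟩
  have hall : ∀ i, (T i).eval (x + ∑ j, δs j) = (T i).eval (x + δ) := fun i =>
    (T i).eval_add_eq fun c => (hsum c).imp_right fun h => ⟨h.1, h.2 i⟩
  refine ⟨δs, fun i j hij c => ?_, fun i c => (ite_eq_or_eq _ _ _).symm, ?_, hδ, hone,
    fun i => (hall i).trans (hone i).symm, ?_, ?_⟩
  · by_cases h : (T i).Crosses x δ c
    · exact Or.inr (if_neg (hdisj i j hij c h))
    · exact Or.inl (if_neg h)
  · refine pNorm_le_pNorm p fun c => ?_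
    rcases hsum c with h | ⟨h, -⟩ <;> simp [h]
  · exact Finset.sum_congr rfl fun i _ => (hall i).trans (hone i).symm
  · exact Finset.sum_congr rfl fun i _ => hall i
end
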